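/- For every natural number p > 4, S(p) = p if and only if p is prime. -/

import Mathlib

/-- The classical Smarandache function: `S n` is the smallest positive integer `m`
such that `n` divides `m!` (this gives `S 1 = 1`). -/
noncomputable def smarandache (n : ℕ) : ℕ := sInf {m : ℕ | 0 < m ∧ n ∣ Nat.factorial m}

theorem smarandache_le {n m : ℕ} (hm : 0 < m) (h : n ∣ Nat.factorial m) : smarandache n ≤ m :=
  Nat.sInf_le ⟨hm, h⟩

theorem Nat.Prime.smarandache_eq {p : ℕ} (hp : p.Prime) : smarandache p = p :=
  le_antisymm (smarandache_le hp.pos (Nat.dvd_factorial hp.pos le_rfl))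
    (le_csInf ⟨p, hp.pos, Nat.dvd_factorial hp.pos le_rfl⟩ fun _ hm => hp.dvd_factorial.1 hm.2)

theorem smarandache_mul_le_add {a b : ℕ} (ha : 0 < a) (hb : 0 < b) :
    smarandache (a * b) ≤ a + b :=
  smarandache_le (by omega) <|
    (mul_dvd_mul (Nat.dvd_factorial ha le_rfl) (Nat.dvd_factorial hb le_rfl)).trans
      (Nat.factorial_mul_factorial_dvd_factorial_add a b)

theorem smarandache_eq_self_iff_prime (p : ℕ) (hp : 4 < p) :
    smarandache p = p ↔ Nat.Prime p := by
  refine ⟨fun h => ?_, Nat.Prime.smarandache_eq⟩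
  by_contra hnp
  obtain ⟨a, b, ha, hb, rfl⟩ := (Nat.not_prime_iff_exists_mul_eq (by omega)).1 hnp
  have ha2 : 2 ≤ a := by by_contra!; interval_cases a <;> omega
  have hb2 : 2 ≤ b := by by_contra!; interval_cases b <;> omega
  have hle := smarandache_mul_le_add (a := a) (b := b) (by omega) (by omega)
  rw [h] at hle
  nlinarith
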